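/- arXiv:2006.06417 — 2 statements merged into one kernel-verified Lean document; each statement's English description precedes it below -/
import Mathlib

section
/- Consider the discretized Lotka-Volterra model of two cooperative groups on n ≥ 1 patches. Let a(j,i,k) ≥ 0 (migration rates, for j ≠ i), b(i,k) ≥ 0 (death rates), c(i,k) ≥ 0 (reproduction rates), and time step τ ≥ 0, for i, j ∈ {0,…,n−1} and k ∈ {0,1}. Define F : (Fin n × Fin 2 → ℝ) → (Fin n × Fin 2 → ℝ) by F(x)(i,k) = x(i,k) + τ·( c(i,k)·x(i,k)·x(i,k̄) − b(i,k)·x(i,k) + ∑_{j ≠ i} a(j,i,k)·(x(j,k) − x(i,k)) ), where k̄ = 1 − k. If τ·( b(i,k) + ∑_{j ≠ i} a(j,i,k) ) ≤ 1 for all i and k, then F is monotone on the nonnegative orthant: for all x, y with 0 ⪯ x ⪯ y componentwise, F(x) ⪯ F(y) componentwise. -/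
/-- The discretized Lotka-Volterra model of two cooperative groups on n patches
is monotone on the nonnegative orthant provided the time step satisfies
τ·(b(i,k) + ∑_{j ≠ i} a(j,i,k)) ≤ 1 for all i, k. -/
theorem LV_monotone (n : ℕ) (hn : 1 ≤ n)
    (a : Fin n → Fin n → Fin 2 → ℝ) (b c : Fin n → Fin 2 → ℝ) (τ : ℝ)
    (ha : ∀ j i k, 0 ≤ a j i k) (hb : ∀ i k, 0 ≤ b i k) (hc : ∀ i k, 0 ≤ c i k)
    (hτ : 0 ≤ τ)
    (F : (Fin n × Fin 2 → ℝ) → (Fin n × Fin 2 → ℝ))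
    (hF : ∀ x : Fin n × Fin 2 → ℝ, ∀ i : Fin n, ∀ k : Fin 2,
      F x (i, k) = x (i, k) + τ * (c i k * x (i, k) * x (i, 1 - k)
        - b i k * x (i, k)
        + ∑ j ∈ Finset.univ \ {i}, a j i k * (x (j, k) - x (i, k))))
    (hstep : ∀ i k, τ * (b i k + ∑ j ∈ Finset.univ \ {i}, a j i k) ≤ 1) :
    ∀ x y : Fin n × Fin 2 → ℝ, (∀ p, 0 ≤ x p) → (∀ p, x p ≤ y p) →
      ∀ p, F x p ≤ F y p := by
  intro x y hx hxy
  rintro ⟨i, k⟩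
  have key : ∀ z : Fin n × Fin 2 → ℝ, F z (i, k) =
      (1 - τ * (b i k + ∑ j ∈ Finset.univ \ {i}, a j i k)) * z (i, k)
        + τ * (c i k * (z (i, k) * z (i, 1 - k)))
        + τ * ∑ j ∈ Finset.univ \ {i}, a j i k * z (j, k) := by
    intro z
    rw [hF]
    simp only [mul_sub, Finset.sum_sub_distrib, ← Finset.sum_mul]
    ring
  rw [key x, key y]
  have h1 := sub_nonneg.2 (hstep i k)
  have h2 : x (i, k) * x (i, 1 - k) ≤ y (i, k) * y (i, 1 - k) :=
    mul_le_mul (hxy _) (hxy _) (hx _) ((hx _).trans (hxy _))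
  refine add_le_add (add_le_add ?_ ?_) ?_
  · exact mul_le_mul_of_nonneg_left (hxy _) h1
  · exact mul_le_mul_of_nonneg_left (mul_le_mul_of_nonneg_left h2 (hc _ _)) hτ
  · exact mul_le_mul_of_nonneg_left
      (Finset.sum_le_sum fun j _ => mul_le_mul_of_nonneg_left (hxy _) (ha _ _ _)) hτ
end

section
/- Consider the discretized biochemical control circuit model with n ≥ 1 enzymes, decay rates α : {0,…,n} → ℝ with α(i) ≥ 0, constant K > 1, exponent p ∈ ℕ, and time step τ ≥ 0. Define F : (Fin (n+1) → ℝ) → (Fin (n+1) → ℝ) by F(x)(0) = x(0) + τ·( (x(n)ᵖ + 1)/(x(n)ᵖ + K) − α(0)·x(0) ) and, for 1 ≤ i ≤ n, F(x)(i) = x(i) + τ·( x(i−1) − α(i)·x(i) ). If τ·α(i) ≤ 1 for all i ∈ {0,…,n}, then F is monotone on the nonnegative orthant: for all x, y ∈ ℝ^{n+1} with 0 ⪯ x ⪯ y componentwise, F(x) ⪯ F(y) componentwise. -/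
/-- The discretized biochemical control circuit model is monotone on the
nonnegative orthant provided τ·α(i) ≤ 1 for all i. -/
theorem BCC_monotone (n : ℕ) (hn : 1 ≤ n)
    (α : Fin (n + 1) → ℝ) (hα : ∀ i, 0 ≤ α i)
    (K : ℝ) (hK : 1 < K) (p : ℕ) (τ : ℝ) (hτ : 0 ≤ τ)
    (F : (Fin (n + 1) → ℝ) → (Fin (n + 1) → ℝ))
    (hF0 : ∀ x : Fin (n + 1) → ℝ,
      F x 0 = x 0 + τ * (((x (Fin.last n)) ^ p + 1) / ((x (Fin.last n)) ^ p + K)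
        - α 0 * x 0))
    (hFi : ∀ x : Fin (n + 1) → ℝ, ∀ i : Fin n,
      F x i.succ = x i.succ + τ * (x i.castSucc - α i.succ * x i.succ))
    (hstep : ∀ i, τ * α i ≤ 1) :
    ∀ x y : Fin (n + 1) → ℝ, (∀ i, 0 ≤ x i) → (∀ i, x i ≤ y i) →
      ∀ i, F x i ≤ F y i := by
  intro x y hx hxy i
  have key : ∀ j, (1 - τ * α j) * x j ≤ (1 - τ * α j) * y j := fun j =>
    mul_le_mul_of_nonneg_left (hxy j) (sub_nonneg.mpr (hstep j))
  refine Fin.cases ?_ (fun j => ?_) i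
  · rw [hF0, hF0]
    have hp : (x (Fin.last n)) ^ p ≤ (y (Fin.last n)) ^ p :=
      pow_le_pow_left₀ (hx _) (hxy _) p
    have h0 : 0 ≤ (x (Fin.last n)) ^ p := pow_nonneg (hx _) p
    generalize (x (Fin.last n)) ^ p = a at *
    generalize (y (Fin.last n)) ^ p = b at *
    have hq : (a + 1) / (a + K) ≤ (b + 1) / (b + K) := by
      rw [div_le_div_iff₀ (by linarith) (by linarith)]
      nlinarith [mul_nonneg (sub_nonneg.mpr hp) (sub_nonneg.mpr hK.le)]
    have h1 := mul_le_mul_of_nonneg_left hq hτ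
    have h2 := key 0
    linarith
  · rw [hFi, hFi]
    have h1 := mul_le_mul_of_nonneg_left (hxy j.castSucc) hτ
    have h2 := key j.succ
    linarith
end
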